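/- arXiv:2407.06548 — 6 statements merged into one kernel-verified Lean document; each statement's English description precedes it below -/
import Mathlib

section
/- Let B = (b_1,…,b_q) and A = (a_1,…,a_r) be sequences of positive integers arranged in descending order, i.e. b_1 ≥ b_2 ≥ ⋯ ≥ b_q and a_1 ≥ a_2 ≥ ⋯ ≥ a_r. If (B;A) satisfies the strong arithmetic condition, then b_i ≥ 2·a_i for every i with 1 ≤ i ≤ r. -/
/-- The strong arithmetic condition (S.A.C.) of Friedlander–Halperin: for every nonempty
subset `S` of the index set of `a`, there are at least `S.card` distinct indices `j` such
that `b j` is a nonnegative integer combination `∑ i ∈ S, γ i * a i` with `∑ i ∈ S, γ i ≥ 2`. -/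
def StrongArithmeticCondition {q r : ℕ} (b : Fin q → ℕ) (a : Fin r → ℕ) : Prop :=
  ∀ S : Finset (Fin r), S.Nonempty →
    ∃ T : Finset (Fin q), S.card ≤ T.card ∧
      ∀ j ∈ T, ∃ γ : Fin r → ℕ, 2 ≤ ∑ i ∈ S, γ i ∧ b j = ∑ i ∈ S, γ i * a i

/-- if `B = (b_1 ≥ ⋯ ≥ b_q)` and `A = (a_1 ≥ ⋯ ≥ a_r)` are descending
sequences of positive integers and `(B; A)` satisfies the strong arithmetic condition,
then `b i ≥ 2 * a i` for `1 ≤ i ≤ r`. -/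
theorem sac_imp_b_ge_two_a {q r : ℕ} (b : Fin q → ℕ) (a : Fin r → ℕ)
    (hb : ∀ j, 0 < b j) (ha : ∀ i, 0 < a i)
    (hbdesc : ∀ j k : Fin q, j ≤ k → b k ≤ b j)
    (hadesc : ∀ i k : Fin r, i ≤ k → a k ≤ a i)
    (hrq : r ≤ q)
    (hsac : StrongArithmeticCondition b a) :
    ∀ i : Fin r, 2 * a i ≤ b (Fin.castLE hrq i) := by
  intro i
  obtain ⟨T, hcard, hT⟩ := hsac (Finset.Iic i) ⟨i, by simp⟩
  obtain ⟨j, hjT, hij⟩ : ∃ j ∈ T, Fin.castLE hrq i ≤ j := by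
    by_contra! h
    have hle : T.card ≤ (Finset.Iio (Fin.castLE hrq i)).card :=
      Finset.card_le_card fun j hj => Finset.mem_Iio.2 (h j hj)
    simp only [Fin.card_Iic, Fin.card_Iio, Fin.val_castLE] at hcard hle
    omega
  obtain ⟨γ, hγ, hbj⟩ := hT j hjT
  calc 2 * a i ≤ (∑ k ∈ Finset.Iic i, γ k) * a i := Nat.mul_le_mul_right _ hγ
    _ = ∑ k ∈ Finset.Iic i, γ k * a i := Finset.sum_mul ..
    _ ≤ ∑ k ∈ Finset.Iic i, γ k * a k := Finset.sum_le_sum fun k hk =>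
        Nat.mul_le_mul_left _ (hadesc k i (Finset.mem_Iic.1 hk))
    _ = b j := hbj.symm
    _ ≤ b (Fin.castLE hrq i) := hbdesc _ _ hij
end

section
/- Let 𝕂 be an infinite field, let r ≥ 1, let a_1,…,a_r be positive integer weights assigned to the variables u_1,…,u_r of the polynomial ring 𝕂[u_1,…,u_r], and let b_1,…,b_q be positive integers. For each i with 1 ≤ i ≤ q let Φ_i = {σ_{i1},…,σ_{iℓ_i}} be a finite family of monomials in u_1,…,u_r, each of total exponent at least 2 (non-linear) and of weighted degree b_i. Then the families Φ_1,…,Φ_q satisfy the polynomial condition if and only if there exist polynomials f_1,…,f_q, where each f_i = Σ_{j=1}^{ℓ_i} c_{ij} σ_{ij} is a 𝕂-linear combination of the monomials in Φ_i, such that the quotient ring 𝕂[u_1,…,u_r]/(f_1,…,f_q) is finite-dimensional as a 𝕂-vector space. -/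
/-- The polynomial condition (P.C.) of Friedlander–Halperin: for every (nonempty) subset
`S` of the variables, there are at least `S.card` distinct families `Φ m` each containing
a non-linear monomial (total exponent at least `2`) only involving the variables in `S`.
A monomial in the variables `u_1, …, u_r` is encoded by its exponent vector in
`Fin r →₀ ℕ`. -/
def PolynomialCondition {q r : ℕ} (Φ : Fin q → Finset (Fin r →₀ ℕ)) : Prop :=
  ∀ S : Finset (Fin r), S.Nonempty →
    ∃ T : Finset (Fin q), S.card ≤ T.card ∧
      ∀ m ∈ T, ∃ d ∈ Φ m, 2 ≤ d.sum (fun _ e => e) ∧ d.support ⊆ S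

open MvPolynomial in
/-- The ideal generated by a set of variables is prime. -/
theorem isPrime_span_X_image {σ R : Type*} [CommRing R] [IsDomain R] (A : Set σ) :
    (Ideal.span (X '' A : Set (MvPolynomial σ R))).IsPrime := by
  classical
  let φ : MvPolynomial σ R →ₐ[R] MvPolynomial σ R := aeval fun i => if i ∈ A then 0 else X i
  have hsub (p : MvPolynomial σ R) : p - φ p ∈ Ideal.span (X '' A) := by
    rw [← Ideal.Quotient.mk_eq_mk_iff_sub_mem]
    have : (Ideal.Quotient.mkₐ R (Ideal.span (X '' A))).comp φ =
        Ideal.Quotient.mkₐ R (Ideal.span (X '' A)) := by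
      ext i
      by_cases hi : i ∈ A
      · have : (X i : MvPolynomial σ R) ∈ Ideal.span (X '' A) :=
          Ideal.subset_span ⟨i, hi, rfl⟩
        simp [φ, hi, Ideal.Quotient.eq_zero_iff_mem.mpr this]
      · simp [φ, hi]
    exact (DFunLike.congr_fun this p).symm
  have hker : Ideal.span (X '' A) = RingHom.ker φ := by
    apply le_antisymm
    · rw [Ideal.span_le]
      rintro _ ⟨i, hi, rfl⟩
      simp [φ, hi]
    · intro p hp
      simpa [RingHom.mem_ker.mp hp] using hsub p
  rw [hker]
  exact RingHom.ker_isPrime φ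

open MvPolynomial in
/-- The ideal generated by `n` variables has height at least `n`. -/
theorem card_le_height_span_X_image {σ K : Type*} [Finite σ] [Field K] (A : Finset σ) :
    (A.card : ℕ∞) ≤ (Ideal.span (X '' (A : Set σ) : Set (MvPolynomial σ K))).height := by
  classical
  induction A using Finset.induction_on with
  | empty => simp
  | insert i A hi ih =>
    have := isPrime_span_X_image (R := K) (A : Set σ)
    have hlt : Ideal.span (X '' (A : Set σ) : Set (MvPolynomial σ K)) <
        Ideal.span (X '' (↑(insert i A) : Set σ)) := by
      refine lt_of_le_of_ne (Ideal.span_mono (Set.image_mono (by simp))) fun h => ?_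
      have hX : (X i : MvPolynomial σ K) ∈ Ideal.span (X '' (A : Set σ)) :=
        h ▸ Ideal.subset_span ⟨i, by simp, rfl⟩
      rw [mem_ideal_span_X_image] at hX
      obtain ⟨j, hj, hne⟩ := hX (Finsupp.single i 1) (by simp [X, support_monomial])
      rw [Finsupp.single_apply_ne_zero] at hne
      exact hi (hne.1 ▸ hj)
    rw [Finset.card_insert_of_notMem hi, Nat.cast_add, Nat.cast_one]
    exact Order.add_one_le_of_lt (ih.trans_lt (Ideal.height_strict_mono_of_isPrime hlt))

/-- If every `f t` with `t ∈ T` avoids the minimal primes of `J` together with the earlier `f i`,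
then each element of `T` raises the height by one. -/
theorem Ideal.height_add_card_le_height {R ι : Type*} [CommRing R] [IsNoetherianRing R]
    [LinearOrder ι] (f : ι → R) (J P : Ideal R) (T : Finset ι)
    (hT : ∀ t ∈ T, ∀ Q ∈ (J ⊔ Ideal.span (f '' Set.Iio t)).minimalPrimes, Q ≤ P → f t ∉ Q)
    (Q : Ideal R) [Q.IsPrime] (hQP : Q ≤ P) (hJQ : J ≤ Q) (hf : ∀ t ∈ T, ∀ i ≤ t, f i ∈ Q) :
    J.height + T.card ≤ Q.height := by
  induction T using Finset.induction_on_max generalizing Q with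
  | empty => simpa using Ideal.height_mono hJQ
  | insert t T hlt ih =>
    have hle : J ⊔ Ideal.span (f '' Set.Iio t) ≤ Q := by
      refine sup_le hJQ (Ideal.span_le.mpr ?_)
      rintro _ ⟨i, hi, rfl⟩
      exact hf t (by simp) i (Set.mem_Iio.mp hi).le
    obtain ⟨P', hmin, hP'Q⟩ := Ideal.exists_minimalPrimes_le hle
    have := hmin.1.1
    have hP'mem {i : ι} (hi : i < t) : f i ∈ P' :=
      hmin.1.2 (Ideal.mem_sup_right (Ideal.subset_span ⟨i, hi, rfl⟩))
    have key := ih (fun s hs => hT s (Finset.mem_insert_of_mem hs)) P' (hP'Q.trans hQP)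
      (le_sup_left.trans hmin.1.2) (fun s hs i hi => hP'mem (hi.trans_lt (hlt s hs)))
    have hlt' : P' < Q := lt_of_le_of_ne hP'Q fun h =>
      hT t (by simp) P' hmin (hP'Q.trans hQP) (h ▸ hf t (by simp) t le_rfl)
    rw [Finset.card_insert_of_notMem fun h => (hlt t h).false]
    push_cast
    rw [← add_assoc]
    exact Order.add_one_le_of_lt (key.trans_lt (Ideal.height_strict_mono_of_isPrime hlt'))

open MvPolynomial in
/-- Over an infinite field, some linear combination of given monomials avoids every member of a
finite set of ideals not containing all of these monomials. -/
theorem exists_linearCombination_notMem {σ K : Type*} [Field K] [Infinite K]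
    (Φ : Finset (σ →₀ ℕ)) (F : Set (Ideal (MvPolynomial σ K))) (hFin : F.Finite) :
    ∃ c : (σ →₀ ℕ) → K, ∀ Q ∈ F, (∃ d ∈ Φ, monomial d (1 : K) ∉ Q) →
      ∑ d ∈ Φ, monomial d (c d) ∉ Q := by
  classical
  let L : ((σ →₀ ℕ) → K) →ₗ[K] MvPolynomial σ K :=
    ∑ d ∈ Φ, (monomial d) ∘ₗ LinearMap.proj d
  have hL (c : (σ →₀ ℕ) → K) : L c = ∑ d ∈ Φ, monomial d (c d) := by simp [L]
  let s : Finset (Subspace K ((σ →₀ ℕ) → K)) :=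
    (hFin.toFinset.filter fun Q => ∃ d ∈ Φ, monomial d (1 : K) ∉ Q).image
      fun Q => (Q.restrictScalars K).comap L
  have hs : ⊤ ∉ s := by
    simp only [s, Finset.mem_image, Finset.mem_filter, not_exists, not_and, and_imp]
    rintro Q - ⟨d, hd, hdQ⟩ htop
    have hmem : Pi.single d (1 : K) ∈ (Q.restrictScalars K).comap L := htop ▸ Submodule.mem_top
    rw [Submodule.mem_comap, Submodule.restrictScalars_mem, hL,
      Finset.sum_eq_single_of_mem d hd (by intro e _ he; simp [he])] at hmem
    exact hdQ (by simpa using hmem)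
  obtain ⟨c, hc⟩ := (Set.ne_univ_iff_exists_notMem _).mp
    (Subspace.biUnion_ne_univ_of_top_notMem hs)
  refine ⟨c, fun Q hQ hd hmem => hc ?_⟩
  simp only [Set.mem_iUnion]
  refine ⟨(Q.restrictScalars K).comap L, ?_, ?_⟩
  · exact Finset.mem_image_of_mem _ (Finset.mem_filter.mpr ⟨hFin.mem_toFinset.mpr hQ, hd⟩)
  · rw [SetLike.mem_coe, Submodule.mem_comap, hL]
    exact hmem

open MvPolynomial in
/-- Generic coefficients: each combination avoids the minimal primes of every ideal generated by
some variables and the earlier combinations, whenever its family of monomials permits. -/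
theorem exists_generic_coefficients {σ ι K : Type*} [Finite σ] [LinearOrder ι]
    [WellFoundedLT ι] [Field K] [Infinite K] (Φ : ι → Finset (σ →₀ ℕ)) :
    ∃ c : ι → (σ →₀ ℕ) → K, ∀ (i : ι) (A : Set σ),
      ∀ Q ∈ (Ideal.span (X '' A) ⊔
        Ideal.span ((fun j => ∑ d ∈ Φ j, monomial d (c j d)) '' Set.Iio i)).minimalPrimes,
      (∃ d ∈ Φ i, monomial d (1 : K) ∉ Q) → ∑ d ∈ Φ i, monomial d (c i d) ∉ Q := by
  have step (i : ι) (prev : ∀ j, j < i → (σ →₀ ℕ) → K) : ∃ c : (σ →₀ ℕ) → K, ∀ A : Set σ,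
      ∀ Q ∈ (Ideal.span (X '' A) ⊔ Ideal.span (Set.range fun j : Set.Iio i =>
        ∑ d ∈ Φ j, monomial d (prev j j.2 d))).minimalPrimes,
      (∃ d ∈ Φ i, monomial d (1 : K) ∉ Q) → ∑ d ∈ Φ i, monomial d (c d) ∉ Q := by
    obtain ⟨c, hc⟩ := exists_linearCombination_notMem (K := K) (Φ i)
      (⋃ A : Set σ, (Ideal.span (X '' A) ⊔ Ideal.span (Set.range fun j : Set.Iio i =>
        ∑ d ∈ Φ j, monomial d (prev j j.2 d))).minimalPrimes)
      (Set.finite_iUnion fun A => Ideal.finite_minimalPrimes_of_isNoetherianRing _ _)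
    exact ⟨c, fun A Q hQ => hc Q (Set.mem_iUnion.mpr ⟨A, hQ⟩)⟩
  choose g hg using step
  let c : ι → (σ →₀ ℕ) → K := wellFounded_lt.fix g
  have hc (i : ι) : c i = g i fun j _ => c j := wellFounded_lt.fix_eq g i
  refine ⟨c, fun i A Q hQ hd => ?_⟩
  rw [hc i]
  refine hg i (fun j _ => c j) A Q ?_ hd
  rwa [Set.image_eq_range _ (Set.Iio i)] at hQ

open MvPolynomial in
/-- For positive weights, a proper weighted homogeneous ideal contains only polynomials without
constant term. -/
theorem le_span_range_X_of_isHomogeneous {σ K : Type*} [Field K] {w : σ → ℕ}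
    (hw : ∀ i, 0 < w i) {P : Ideal (MvPolynomial σ K)} (hP : P ≠ ⊤)
    (hhom : letI := weightedGradedAlgebra K w
      P.IsHomogeneous (weightedHomogeneousSubmodule K w)) :
    P ≤ Ideal.span (X '' (Set.univ : Set σ)) := by
  intro p hp
  have h0 := weightedHomogeneousComponent_mem_of_mem K w hhom hp 0
  rw [weightedHomogeneousComponent_zero p fun i => (hw i).ne'] at h0
  have hcoeff : coeff 0 p = 0 := by
    by_contra hne
    exact hP (Ideal.eq_top_of_isUnit_mem _ h0 ((IsUnit.mk0 _ hne).map C))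
  rw [mem_ideal_span_X_image]
  intro m hm
  by_contra! hzero
  have : m = 0 := Finsupp.ext fun i => hzero i (Set.mem_univ i)
  rw [this, mem_support_iff] at hm
  exact hm hcoeff

open MvPolynomial in
/-- If all variables are nilpotent modulo an ideal, then the quotient is finite-dimensional. -/
theorem finiteDimensional_quotient_of_X_mem_radical {σ K : Type*} [Finite σ] [Field K]
    {I : Ideal (MvPolynomial σ K)} (h : ∀ i, X i ∈ I.radical) :
    FiniteDimensional K (MvPolynomial σ K ⧸ I) := by
  have hint : Algebra.IsIntegral K (MvPolynomial σ K ⧸ I) := by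
    refine ⟨fun x => ?_⟩
    obtain ⟨p, rfl⟩ := Ideal.Quotient.mk_surjective x
    induction p using MvPolynomial.induction_on with
    | C k => exact isIntegral_algebraMap (A := MvPolynomial σ K ⧸ I) (x := k)
    | add p q hp hq => simpa using hp.add hq
    | mul_X p i hp =>
      rw [map_mul]
      refine hp.mul ?_
      obtain ⟨n, hn⟩ := h i
      have hzero : Ideal.Quotient.mk I (X i) ^ (n + 1) = 0 := by
        rw [← map_pow, Ideal.Quotient.eq_zero_iff_mem, pow_succ]
        exact I.mul_mem_right _ hn
      exact IsIntegral.of_pow n.succ_pos (hzero ▸ isIntegral_zero)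
  exact Algebra.IsIntegral.finite

open MvPolynomial in
/-- If finitely many polynomials have a finite-dimensional quotient, then for every set `S` of
variables at least `S.card` of them are nonzero after killing the variables outside `S`. -/
theorem card_le_card_of_finiteDimensional_quotient {σ ι K : Type*} [Fintype σ] [DecidableEq σ]
    [Field K] (f : ι → MvPolynomial σ K)
    [FiniteDimensional K (MvPolynomial σ K ⧸ Ideal.span (Set.range f))]
    (hf : ∀ i, f i ∈ Ideal.span (X '' (Set.univ : Set σ))) (S : Finset σ) (T : Finset ι)
    (hT : ∀ i ∉ T, f i ∈ Ideal.span (X '' (↑Sᶜ : Set σ))) : S.card ≤ T.card := by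
  classical
  let M : Ideal (MvPolynomial σ K) := Ideal.span (X '' (Set.univ : Set σ))
  have hM : M.IsPrime := isPrime_span_X_image _
  let G : Finset (MvPolynomial σ K) := Sᶜ.image X ∪ T.image f
  have hXG {j : σ} (hj : j ∈ Sᶜ) : X j ∈ Ideal.span (G : Set (MvPolynomial σ K)) :=
    Ideal.subset_span (Finset.mem_union_left _ (Finset.mem_image_of_mem _ hj))
  have hIG : Ideal.span (Set.range f) ≤ Ideal.span (G : Set (MvPolynomial σ K)) := by
    rw [Ideal.span_le]
    rintro _ ⟨i, rfl⟩
    by_cases hi : i ∈ T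
    · exact Ideal.subset_span (Finset.mem_union_right _ (Finset.mem_image_of_mem _ hi))
    · refine Ideal.span_le.mpr ?_ (hT i hi)
      rintro _ ⟨j, hj, rfl⟩
      exact hXG hj
  have hGM : Ideal.span (G : Set (MvPolynomial σ K)) ≤ M := by
    rw [Ideal.span_le]
    intro p hp
    rcases Finset.mem_union.mp hp with hp | hp <;> obtain ⟨j, -, rfl⟩ := Finset.mem_image.mp hp
    · exact Ideal.subset_span ⟨j, Set.mem_univ j, rfl⟩
    · exact hf j
  have hmin : M ∈ (Ideal.span (G : Set (MvPolynomial σ K))).minimalPrimes := by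
    refine ⟨⟨hM, hGM⟩, fun Q ⟨hQ, hGQ⟩ hQM => ?_⟩
    have hfin : Module.Finite K (MvPolynomial σ K ⧸ Q) :=
      Module.Finite.of_surjective (Ideal.Quotient.factorₐ K (hIG.trans hGQ)).toLinearMap
        (Ideal.Quotient.factor_surjective (hIG.trans hGQ))
    have hfield : IsField (MvPolynomial σ K ⧸ Q) :=
      isField_of_isIntegral_of_isField' (Field.toIsField K)
    exact ((Ideal.Quotient.maximal_of_isField Q hfield).eq_of_le hM.ne_top hQM).ge
  have hlow := card_le_height_span_X_image (K := K) (Finset.univ : Finset σ)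
  rw [Finset.coe_univ] at hlow
  have hheight := hlow.trans (Ideal.height_le_card_of_mem_minimalPrimes_span_finset hmin)
  have hcard : G.card ≤ Sᶜ.card + T.card :=
    (Finset.card_union_le _ _).trans (Nat.add_le_add Finset.card_image_le Finset.card_image_le)
  have := Nat.cast_le.mp hheight
  rw [Finset.card_univ, ← Finset.card_add_card_compl S] at this
  omega

open MvPolynomial in
/-- A monomial belongs to the ideal of a set of variables if one of them divides it. -/
theorem monomial_mem_span_X_image {σ R : Type*} [CommSemiring R] {A : Set σ} {d : σ →₀ ℕ} {j : σ}
    (hj : j ∈ A) (hd : d j ≠ 0) (k : R) : monomial d k ∈ Ideal.span (X '' A) := by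
  classical
  rw [mem_ideal_span_X_image]
  intro m hm
  rw [Finset.mem_singleton.mp (support_monomial_subset hm)]
  exact ⟨j, hj, hd⟩

open MvPolynomial in
/-- A prime ideal contains a monomial only if it contains one of the variables dividing it. -/
theorem monomial_notMem_of_isPrime {σ R : Type*} [CommSemiring R] {P : Ideal (MvPolynomial σ R)}
    [hP : P.IsPrime] {d : σ →₀ ℕ} (hd : ∀ j ∈ d.support, X j ∉ P) :
    monomial d (1 : R) ∉ P := by
  rw [monomial_eq, C_1, one_mul, Finsupp.prod]
  intro hmem
  obtain ⟨j, hj, hjP⟩ := hP.prod_mem_iff.mp hmem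
  exact hd j hj (hP.mem_of_pow_mem _ hjP)

/-- Friedlander–Halperin: with weights `a i` on the variables `u_1, …, u_r`
and families `Φ i` of non-linear monomials of weighted degree `b i`, the families satisfy
the polynomial condition iff there are polynomials `f i`, each a `𝕂`-linear combination of
the monomials of `Φ i`, such that `𝕂[u_1, …, u_r]/(f_1, …, f_q)` is finite-dimensional
over `𝕂`. -/
theorem polynomialCondition_iff_finiteDimensional_quotient
    (𝕂 : Type*) [Field 𝕂] [Infinite 𝕂] {q r : ℕ} (hr : 1 ≤ r)
    (a : Fin r → ℕ) (ha : ∀ i, 0 < a i) (b : Fin q → ℕ) (hb : ∀ i, 0 < b i)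
    (Φ : Fin q → Finset (Fin r →₀ ℕ))
    (hΦ : ∀ i, ∀ d ∈ Φ i, 2 ≤ d.sum (fun _ e => e) ∧ d.sum (fun j e => e * a j) = b i) :
    PolynomialCondition Φ ↔
      ∃ c : (i : Fin q) → (Fin r →₀ ℕ) → 𝕂,
        FiniteDimensional 𝕂
          (MvPolynomial (Fin r) 𝕂 ⧸
            Ideal.span (Set.range fun i : Fin q =>
              ∑ d ∈ Φ i, MvPolynomial.monomial d (c i d))) := by
  classical
  constructor
  · intro hPC
    obtain ⟨c, hc⟩ := exists_generic_coefficients (K := 𝕂) Φ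
    refine ⟨c, finiteDimensional_quotient_of_X_mem_radical fun j => ?_⟩
    rw [Ideal.radical_eq_sInf, Submodule.mem_sInf]
    rintro P' ⟨hIP', hP'⟩
    let := MvPolynomial.weightedGradedAlgebra 𝕂 a
    let P := (Ideal.homogeneousCore (MvPolynomial.weightedHomogeneousSubmodule 𝕂 a) P').toIdeal
    have hP : P.IsPrime := hP'.homogeneousCore
    have hfP (i : Fin q) : ∑ d ∈ Φ i, MvPolynomial.monomial d (c i d) ∈ P := by
      refine Ideal.mem_homogeneousCore_of_homogeneous_of_mem ⟨b i, ?_⟩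
        (hIP' (Ideal.subset_span ⟨i, rfl⟩))
      refine Submodule.sum_mem _ fun d hd => ?_
      exact MvPolynomial.isWeightedHomogeneous_monomial a d _ (hΦ i d hd).2
    have hPM := le_span_range_X_of_isHomogeneous ha hP.ne_top
      (Ideal.homogeneousCore (MvPolynomial.weightedHomogeneousSubmodule 𝕂 a) P').isHomogeneous
    refine Ideal.toIdeal_homogeneousCore_le _ P' (?_ : MvPolynomial.X j ∈ P)
    by_contra hj
    let S : Finset (Fin r) := Finset.univ.filter fun i => MvPolynomial.X i ∉ P
    obtain ⟨T, hcard, hT⟩ := hPC S ⟨j, by simp [S, hj]⟩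
    have hJP : Ideal.span (MvPolynomial.X '' (↑Sᶜ : Set (Fin r))) ≤ P := by
      rw [Ideal.span_le]
      rintro _ ⟨i, hi, rfl⟩
      simpa [S] using hi
    have hheight := Ideal.height_add_card_le_height _
      (Ideal.span (MvPolynomial.X '' (↑Sᶜ : Set (Fin r)))) P T
      (fun t ht Q hQ hQP => hc t _ Q hQ (by
        obtain ⟨d, hd, -, hdS⟩ := hT t ht
        refine ⟨d, hd, fun hmem => monomial_notMem_of_isPrime (fun i hi => ?_) (hQP hmem)⟩
        exact (Finset.mem_filter.mp (hdS hi)).2))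
      P le_rfl hJP (fun t _ i _ => hfP i)
    have hlt : P < Ideal.span (MvPolynomial.X '' (Set.univ : Set (Fin r))) :=
      lt_of_le_of_ne hPM fun h => hj (h ▸ Ideal.subset_span ⟨j, Set.mem_univ j, rfl⟩)
    have hM := isPrime_span_X_image (R := 𝕂) (Set.univ : Set (Fin r))
    have hMr : (Ideal.span (MvPolynomial.X '' (Set.univ : Set (Fin r)) :
        Set (MvPolynomial (Fin r) 𝕂))).height ≤ (r : ℕ∞) := by
      have hmin : Ideal.span (MvPolynomial.X '' (Set.univ : Set (Fin r))) ∈ (Ideal.span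
          ((Finset.univ.image MvPolynomial.X : Finset (MvPolynomial (Fin r) 𝕂)) :
            Set (MvPolynomial (Fin r) 𝕂))).minimalPrimes := by
        rw [Finset.coe_image, Finset.coe_univ, Ideal.minimalPrimes_eq_subsingleton_self]
        rfl
      refine (Ideal.height_le_card_of_mem_minimalPrimes_span_finset hmin).trans ?_
      exact_mod_cast Finset.card_image_le.trans (Finset.card_fin r).le
    have hlow : (r : ℕ∞) ≤ P.height := by
      refine le_trans ?_ hheight
      refine le_trans ?_ (add_le_add_left (card_le_height_span_X_image Sᶜ) _)
      have := Finset.card_add_card_compl S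
      rw [Fintype.card_fin] at this
      exact_mod_cast (by omega : r ≤ Sᶜ.card + T.card)
    exact (hlow.trans_lt (Ideal.height_strict_mono_of_isPrime hlt)).not_ge hMr
  · rintro ⟨c, hfin⟩ S -
    refine ⟨Finset.univ.filter fun m => ∃ d ∈ Φ m, 2 ≤ d.sum (fun _ e => e) ∧ d.support ⊆ S,
      ?_, fun m hm => (Finset.mem_filter.mp hm).2⟩
    refine card_le_card_of_finiteDimensional_quotient
      (fun i => ∑ d ∈ Φ i, MvPolynomial.monomial d (c i d)) (fun i => ?_) S _ fun i hi => ?_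
    · refine Ideal.sum_mem _ fun d hd => ?_
      obtain ⟨j, hj⟩ : ∃ j, d j ≠ 0 := by
        by_contra! hzero
        have h2 := (hΦ i d hd).1
        rw [show d = 0 from Finsupp.ext hzero, Finsupp.sum_zero_index] at h2
        omega
      exact monomial_mem_span_X_image (Set.mem_univ j) hj _
    · refine Ideal.sum_mem _ fun d hd => ?_
      have hsupp : ¬ d.support ⊆ S := fun h =>
        hi (Finset.mem_filter.mpr ⟨Finset.mem_univ i, d, hd, (hΦ i d hd).1, h⟩)
      obtain ⟨j, hj, hjS⟩ := Finset.not_subset.mp hsupp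
      exact monomial_mem_span_X_image (by simpa using hjS) (Finsupp.mem_support_iff.mp hj) _
end

section
/- Let q ≥ r be natural numbers, let b_1,…,b_q be integers with b_j ≥ 2 for all j, let a_1,…,a_r be integers with a_i ≥ 1 for all i, assume b_i ≥ 2·a_i for 1 ≤ i ≤ r, and set n := Σ_{j=1}^q (2b_j − 1) − Σ_{i=1}^r (2a_i − 1). Then Σ_{j=1}^q (2b_j − 1) ≤ 2n − q; in particular, if q ≥ 1 then Σ_{j=1}^q (2b_j − 1) ≤ 2n − 1. -/
/-- with `q ≥ r`, `b j ≥ 2`, `a i ≥ 1`, `b i ≥ 2 a i` for `i ≤ r`, and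
`n = ∑ (2 b j − 1) − ∑ (2 a i − 1)`, one has `∑ (2 b j − 1) ≤ 2 n − q`; in particular if
`q ≥ 1` then `∑ (2 b j − 1) ≤ 2 n − 1`. -/
theorem sum_odd_degrees_le {q r : ℕ} (hrq : r ≤ q)
    (b : Fin q → ℤ) (a : Fin r → ℤ)
    (hb : ∀ j, 2 ≤ b j) (ha : ∀ i, 1 ≤ a i)
    (hba : ∀ i : Fin r, 2 * a i ≤ b (Fin.castLE hrq i))
    (n : ℤ) (hn : n = ∑ j, (2 * b j - 1) - ∑ i, (2 * a i - 1)) :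
    (∑ j, (2 * b j - 1) ≤ 2 * n - q) ∧ (1 ≤ q → ∑ j, (2 * b j - 1) ≤ 2 * n - 1) := by
  have hsum : ∑ i, (4 * a i - 2) ≤ ∑ j, (2 * b j - 2) :=
    calc ∑ i, (4 * a i - 2) ≤ ∑ i, (2 * b (Fin.castLEEmb hrq i) - 2) :=
          Finset.sum_le_sum fun i _ => by
            have := hba i
            simp only [Fin.castLEEmb_apply]
            linarith
      _ = ∑ j ∈ Finset.univ.map (Fin.castLEEmb hrq), (2 * b j - 2) :=
          by rw [Finset.sum_map]
      _ ≤ ∑ j, (2 * b j - 2) :=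
          Finset.sum_le_univ_sum_of_nonneg fun j => by linarith [hb j]
  have hmain : ∑ j, (2 * b j - 1) ≤ 2 * n - q := by
    simp only [Finset.sum_sub_distrib, ← Finset.mul_sum, Finset.sum_const, Finset.card_univ,
      Fintype.card_fin, nsmul_eq_mul] at hsum hn ⊢
    linarith
  exact ⟨hmain, fun hq => by omega⟩
end

section
/- Let q ≥ r be natural numbers with q ≥ 1, let b_1,…,b_q and a_1,…,a_r be positive integers, and let n be a natural number with Σ_{j=1}^q b_j ≤ n. Then, as real numbers, 2^{q−r} · (Π_{j=1}^q b_j)/(Π_{i=1}^r a_i) ≤ (2n/q)^q. -/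
/-- The AM–GM inequality in product form: a product of nonnegative reals is at most the power of
their average. -/
theorem Finset.prod_le_sum_div_card_pow {ι : Type*} {s : Finset ι} (hs : s.Nonempty) (z : ι → ℝ)
    (hz : ∀ i ∈ s, 0 ≤ z i) : ∏ i ∈ s, z i ≤ ((∑ i ∈ s, z i) / s.card) ^ s.card := by
  have h := Real.geom_mean_le_arith_mean s (fun _ => 1) z (fun _ _ => zero_le_one)
    (by simpa using hs) hz
  simp only [Real.rpow_one, one_mul, Finset.sum_const, nsmul_eq_mul, mul_one] at h
  calc ∏ i ∈ s, z i = ((∏ i ∈ s, z i) ^ (s.card : ℝ)⁻¹) ^ s.card :=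
        (Real.rpow_inv_natCast_pow (Finset.prod_nonneg hz) hs.card_ne_zero).symm
    _ ≤ ((∑ i ∈ s, z i) / s.card) ^ s.card :=
        pow_le_pow_left₀ (Real.rpow_nonneg (Finset.prod_nonneg hz) _) h _


/-- with `q ≥ r`, `q ≥ 1`, positive integers `b j`, `a i` and
`∑ b j ≤ n`, one has `2 ^ (q − r) * ∏ b j / ∏ a i ≤ (2 n / q) ^ q` as real numbers
(via the AM–GM inequality applied to `b_1, …, b_q`). -/
theorem Q_one_le_am_gm_bound {q r : ℕ} (hrq : r ≤ q) (hq : 1 ≤ q)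
    (b : Fin q → ℕ) (a : Fin r → ℕ) (hb : ∀ j, 0 < b j) (ha : ∀ i, 0 < a i)
    (n : ℕ) (hn : ∑ j, b j ≤ n) :
    (2 : ℝ) ^ (q - r) * (∏ j, (b j : ℝ)) / (∏ i, (a i : ℝ)) ≤
      (2 * (n : ℝ) / (q : ℝ)) ^ q := by
  have hne : (Finset.univ : Finset (Fin q)).Nonempty := ⟨⟨0, hq⟩, Finset.mem_univ _⟩
  have hprod : ∏ j, (b j : ℝ) ≤ ((∑ j, (b j : ℝ)) / q) ^ q := by
    simpa using Finset.prod_le_sum_div_card_pow hne (fun j => (b j : ℝ))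
      fun j _ => Nat.cast_nonneg (b j)
  have hsum : ∑ j, (b j : ℝ) ≤ n := by exact_mod_cast hn
  have hden : (1 : ℝ) ≤ ∏ i, (a i : ℝ) := by
    exact_mod_cast Finset.prod_pos fun i _ => ha i
  calc (2 : ℝ) ^ (q - r) * (∏ j, (b j : ℝ)) / (∏ i, (a i : ℝ))
      ≤ (2 : ℝ) ^ (q - r) * ∏ j, (b j : ℝ) := div_le_self (by positivity) hden
    _ ≤ 2 ^ q * ((∑ j, (b j : ℝ)) / q) ^ q := by
        gcongr
        · exact one_le_two
        · exact Nat.sub_le q r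
    _ ≤ 2 ^ q * ((n : ℝ) / q) ^ q := by gcongr
    _ = (2 * (n : ℝ) / (q : ℝ)) ^ q := by rw [← mul_pow, mul_div_assoc]
end

section
/- Let q ≥ r be natural numbers, let b_1,…,b_q and a_1,…,a_r be positive integers, and let n be a natural number with Σ_{j=1}^q b_j ≤ n. Then Π_{j=1}^q (2b_j) ≤ 2^{n−r} · Π_{i=1}^r (2a_i); equivalently, as real numbers, 2^{q−r} · (Π_{j=1}^q b_j)/(Π_{i=1}^r a_i) ≤ 2^{n−r}. -/
theorem Nat.two_mul_le_two_pow {m : ℕ} (hm : 0 < m) : 2 * m ≤ 2 ^ m := by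
  obtain ⟨k, rfl⟩ := Nat.exists_eq_succ_of_ne_zero hm.ne'
  have := Nat.lt_two_pow_self (n := k)
  rw [pow_succ]
  lia

/-- with `q ≥ r`, positive integers `b j`, `a i`, and `∑ b j ≤ n`, one has
`∏ (2 b j) ≤ 2 ^ (n − r) * ∏ (2 a i)`; equivalently
`2 ^ (q − r) * ∏ b j / ∏ a i ≤ 2 ^ (n − r)`. -/
theorem prod_two_b_le_two_pow_n_sub_r {q r : ℕ} (hrq : r ≤ q)
    (b : Fin q → ℕ) (a : Fin r → ℕ) (hb : ∀ j, 0 < b j) (ha : ∀ i, 0 < a i)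
    (n : ℕ) (hn : ∑ j, b j ≤ n) :
    (∏ j, 2 * b j ≤ 2 ^ (n - r) * ∏ i, 2 * a i) ∧
      (2 : ℝ) ^ (q - r) * (∏ j, (b j : ℝ)) / (∏ i, (a i : ℝ)) ≤ 2 ^ (n - r) := by
  have hqn : q ≤ n := by
    have := Finset.card_nsmul_le_sum Finset.univ b 1 fun j _ => hb j
    simp only [Finset.card_univ, Fintype.card_fin, smul_eq_mul, mul_one] at this
    exact this.trans hn
  have hprod : ∏ j, 2 * b j ≤ 2 ^ (n - r) * ∏ i, 2 * a i := by
    calc ∏ j, 2 * b j ≤ ∏ j, 2 ^ b j :=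
          Finset.prod_le_prod' fun j _ => Nat.two_mul_le_two_pow (hb j)
      _ = 2 ^ ∑ j, b j := Finset.prod_pow_eq_pow_sum _ _ _
      _ ≤ 2 ^ n := Nat.pow_le_pow_right two_pos hn
      _ = 2 ^ (n - r) * 2 ^ r := (pow_sub_mul_pow 2 (hrq.trans hqn)).symm
      _ = 2 ^ (n - r) * ∏ _i : Fin r, 2 := by simp
      _ ≤ 2 ^ (n - r) * ∏ i, 2 * a i :=
          Nat.mul_le_mul_left _ <| Finset.prod_le_prod' fun i _ =>
            Nat.le_mul_of_pos_right 2 (ha i)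
  refine ⟨hprod, ?_⟩
  have hapos : (0 : ℝ) < ∏ i, (a i : ℝ) :=
    Finset.prod_pos fun i _ => Nat.cast_pos.2 (ha i)
  rw [div_le_iff₀ hapos]
  refine le_of_mul_le_mul_left ?_ (pow_pos (two_pos : (0 : ℝ) < 2) r)
  have hcast : (∏ j, 2 * (b j : ℝ)) ≤ 2 ^ (n - r) * ∏ i, 2 * (a i : ℝ) := by
    exact_mod_cast hprod
  simp only [Finset.prod_mul_distrib, Finset.prod_const, Finset.card_univ,
    Fintype.card_fin] at hcast
  rw [← mul_assoc, pow_mul_pow_sub 2 hrq]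
  linarith
end

section
/- Let f and g be polynomials with real coefficients, all of whose coefficients are nonnegative, such that the constant coefficient of g is at least 1 and g has a strictly positive coefficient in some degree d ≥ 1. Then for every real ε > 0 there exists a natural number N(ε) such that for all natural numbers n ≥ N(ε) and all real t ≥ ε, n·f(t) < (g(t))^n. -/
/-- A polynomial with nonnegative coefficients dominates, on `[0, ∞)`, the sum of its constant
term and any one of its monomials of positive degree. -/
theorem Polynomial.coeff_zero_add_le_eval_of_nonneg {g : Polynomial ℝ} (hg : ∀ k, 0 ≤ g.coeff k)
    {d : ℕ} (hd : 1 ≤ d) (hgd : 0 < g.coeff d) {t : ℝ} (ht : 0 ≤ t) :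
    g.coeff 0 + g.coeff d * t ^ d ≤ g.eval t := by
  have hle : d ≤ g.natDegree := Polynomial.le_natDegree_of_ne_zero hgd.ne'
  have hsub : ({0, d} : Finset ℕ) ⊆ Finset.range (g.natDegree + 1) := by
    intro x hx
    simp only [Finset.mem_insert, Finset.mem_singleton] at hx
    simp only [Finset.mem_range]
    omega
  have hsum := Finset.sum_le_sum_of_subset_of_nonneg (f := fun k => g.coeff k * t ^ k) hsub
    (fun k _ _ => mul_nonneg (hg k) (pow_nonneg ht k))
  rw [Finset.sum_pair (by omega)] at hsum
  rw [Polynomial.eval_eq_sum_range]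
  simpa using hsum

/-- A polynomial with nonnegative coefficients is dominated on `[0, ∞)` by a multiple of a power
of `1 + c * t`. -/
theorem Polynomial.exists_eval_le_mul_one_add_mul_pow {f : Polynomial ℝ}
    (hf : ∀ k, 0 ≤ f.coeff k) {c : ℝ} (hc : 0 < c) :
    ∃ C : ℝ, 0 ≤ C ∧ ∀ t : ℝ, 0 ≤ t → f.eval t ≤ C * (1 + c * t) ^ f.natDegree := by
  refine ⟨∑ k ∈ Finset.range (f.natDegree + 1), f.coeff k * (c⁻¹) ^ k,
    Finset.sum_nonneg fun k _ => mul_nonneg (hf k) (by positivity), fun t ht => ?_⟩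
  rw [Polynomial.eval_eq_sum_range, Finset.sum_mul]
  refine Finset.sum_le_sum fun k hk => ?_
  rw [mul_assoc]
  refine mul_le_mul_of_nonneg_left ?_ (hf k)
  have hct : 0 ≤ c * t := by positivity
  calc t ^ k = (c⁻¹) ^ k * (c * t) ^ k := by
        rw [← mul_pow, inv_mul_cancel_left₀ hc.ne']
    _ ≤ (c⁻¹) ^ k * (1 + c * t) ^ k := by
        gcongr
        linarith
    _ ≤ (c⁻¹) ^ k * (1 + c * t) ^ f.natDegree := by
        gcongr
        · linarith
        · exact Nat.lt_succ_iff.mp (Finset.mem_range.mp hk)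

/-- An exponential with base greater than `1` eventually exceeds any linear function. -/
theorem eventually_natCast_mul_lt_pow (C : ℝ) {q : ℝ} (hq : 1 < q) :
    ∀ᶠ n : ℕ in Filter.atTop, (n : ℝ) * C < q ^ n := by
  have h := (tendsto_pow_const_div_const_pow_of_one_lt 1 hq).mul_const C
  rw [zero_mul] at h
  filter_upwards [h.eventually_lt_const one_pos] with n hn
  have hpos : 0 < q ^ n := by positivity
  rwa [pow_one, div_mul_eq_mul_div, div_lt_one hpos] at hn

/-- if `f`, `g` are real polynomials with nonnegative coefficients, the
constant coefficient of `g` is at least `1` and `g` has a strictly positive coefficient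
in some degree `d ≥ 1`, then for every `ε > 0` there is `N(ε)` with
`n * f(t) < g(t) ^ n` for all `n ≥ N(ε)` and all `t ≥ ε`. -/
theorem hilali_mod_products_poincare (f g : Polynomial ℝ)
    (hf : ∀ k, 0 ≤ f.coeff k) (hg : ∀ k, 0 ≤ g.coeff k)
    (hg0 : 1 ≤ g.coeff 0) (hgd : ∃ d, 1 ≤ d ∧ 0 < g.coeff d) :
    ∀ ε : ℝ, 0 < ε → ∃ N : ℕ, ∀ n : ℕ, N ≤ n → ∀ t : ℝ, ε ≤ t →
      (n : ℝ) * f.eval t < (g.eval t) ^ n := by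
  intro ε hε
  obtain ⟨d, hd, hgd⟩ := hgd
  obtain ⟨c, hc, hcg⟩ : ∃ c : ℝ, 0 < c ∧ ∀ t, ε ≤ t → 1 + c * t ≤ g.eval t := by
    refine ⟨g.coeff d * ε ^ (d - 1), by positivity, fun t ht => ?_⟩
    have ht0 : 0 ≤ t := hε.le.trans ht
    have hpow : ε ^ (d - 1) * t ≤ t ^ d := by
      calc ε ^ (d - 1) * t ≤ t ^ (d - 1) * t := by gcongr
        _ = t ^ d := by rw [← pow_succ, Nat.sub_add_cancel hd]
    have hmul := mul_le_mul_of_nonneg_left hpow hgd.le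
    have heval := Polynomial.coeff_zero_add_le_eval_of_nonneg hg hd hgd ht0
    linarith
  obtain ⟨C, hC, hfC⟩ := Polynomial.exists_eval_le_mul_one_add_mul_pow hf hc
  set m := f.natDegree
  set q := 1 + c * ε with hq_def
  have hq : 1 < q := by
    have : 0 < c * ε := by positivity
    linarith
  obtain ⟨N, hN⟩ := Filter.eventually_atTop.mp
    ((eventually_natCast_mul_lt_pow (C * q ^ m) hq).and (Filter.eventually_ge_atTop m))
  refine ⟨N, fun n hn t ht => ?_⟩
  obtain ⟨hlt, hmn⟩ := hN n hn
  have hqt : q ≤ 1 + c * t := by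
    rw [hq_def]
    gcongr
  have hq0 : 0 < q := by linarith
  have hu0 : 0 < 1 + c * t := by linarith
  have hlt' : (n : ℝ) * C < q ^ (n - m) := by
    rw [← Nat.sub_add_cancel hmn, pow_add, Nat.sub_add_cancel hmn, ← mul_assoc] at hlt
    exact lt_of_mul_lt_mul_right hlt (by positivity)
  calc (n : ℝ) * f.eval t ≤ n * (C * (1 + c * t) ^ m) := by
        gcongr
        exact hfC t (hε.le.trans ht)
    _ = n * C * (1 + c * t) ^ m := by ring
    _ < q ^ (n - m) * (1 + c * t) ^ m := by gcongr
    _ ≤ (1 + c * t) ^ (n - m) * (1 + c * t) ^ m := by gcongr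
    _ = (1 + c * t) ^ n := by rw [← pow_add, Nat.sub_add_cancel hmn]
    _ ≤ (g.eval t) ^ n := by
        gcongr
        exact hcg t ht
end
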